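/- Let c₁, …, c_k be positive integers, put h = c₁ + ⋯ + c_k, and let C² denote the 2k-tuple (c₁, c₁, c₂, c₂, …, c_k, c_k). Then for every integer n ≥ 0: q_{2k}(C²; 8n + 2h) = δ_{2k}(C²; n) = Σ_{(a,b) ∈ ℕ², a+2b=n} r_k(c₁,…,c_k; a)·δ_k(c₁,…,c_k; b) = Σ_{(a,b) ∈ ℕ², a+2b=n} r_k(c₁,…,c_k; a)·q_k(c₁,…,c_k; 8b + h). -/

import Mathlib

/-- `deltaRep k c n` is the number of `k`-tuples `(x₁, …, x_k)` of nonnegative integers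
with `n = Σᵢ cᵢ · xᵢ(xᵢ+1)/2`. -/
noncomputable def deltaRep (k : ℕ) (c : Fin k → ℕ) (n : ℕ) : ℕ :=
  Set.ncard {x : Fin k → ℕ | n = ∑ i, c i * (x i * (x i + 1) / 2)}

/-- `rRep v b n` is the number of `v`-tuples `(y₁, …, y_v)` of integers with
`n = Σᵢ bᵢ · yᵢ²`. -/
noncomputable def rRep (v : ℕ) (b : Fin v → ℕ) (n : ℕ) : ℕ :=
  Set.ncard {y : Fin v → ℤ | (n : ℤ) = ∑ i, (b i : ℤ) * y i ^ 2}

/-- `qRep k c n` is the number of `k`-tuples `(y₁, …, y_k)` of positive odd integers with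
`n = Σᵢ cᵢ · yᵢ²`. -/
noncomputable def qRep (k : ℕ) (c : Fin k → ℕ) (n : ℕ) : ℕ :=
  Set.ncard {y : Fin k → ℕ | (∀ i, 0 < y i ∧ Odd (y i)) ∧ n = ∑ i, c i * y i ^ 2}

/-- `NstRep v k b c n` is the number of pairs of tuples `((y₁, …, y_v), (z₁, …, z_k))`
with the `yᵢ` integers and the `z_j` nonnegative integers such that
`n = Σᵢ bᵢ·yᵢ² + Σⱼ cⱼ·zⱼ(zⱼ+1)/2`. -/
noncomputable def NstRep (v k : ℕ) (b : Fin v → ℕ) (c : Fin k → ℕ) (n : ℕ) : ℕ :=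
  Set.ncard {p : (Fin v → ℤ) × (Fin k → ℕ) |
    (n : ℤ) = ∑ i, (b i : ℤ) * p.1 i ^ 2 +
      ∑ j, (c j : ℤ) * ((p.2 j * (p.2 j + 1) / 2 : ℕ) : ℤ)}

/-- The finite set of pairs `(a, b)` of nonnegative integers with `a + 2b = n`. -/
def convPairs (n : ℕ) : Finset (ℕ × ℕ) :=
  (Finset.range (n + 1) ×ˢ Finset.range (n + 1)).filter fun p => p.1 + 2 * p.2 = n

/-- The bijection `ℕ × ℕ ≃ ℤ × ℕ` carrying `x(x+1)/2 + y(y+1)/2` to `u² + 2 · z(z+1)/2`. -/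
def triangularPairEquiv : ℕ × ℕ ≃ ℤ × ℕ where
  toFun p :=
    if (p.1 + p.2) % 2 = 0 then (((p.1 : ℤ) - p.2) / 2, (p.1 + p.2) / 2)
    else if p.2 < p.1 then (((p.1 : ℤ) + p.2 + 1) / 2, (p.1 - p.2 - 1) / 2)
    else (-(((p.1 : ℤ) + p.2 + 1) / 2), (p.2 - p.1 - 1) / 2)
  invFun q :=
    if q.1.natAbs ≤ q.2 then ((q.2 + q.1).toNat, (q.2 - q.1).toNat)
    else if 0 < q.1 then ((q.1 + q.2).toNat, (q.1 - 1 - q.2).toNat)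
    else ((-q.1 - 1 - q.2).toNat, (q.2 - q.1).toNat)
  left_inv := by
    rintro ⟨x, y⟩
    dsimp only
    split_ifs <;> ext <;> dsimp only at * <;> omega
  right_inv := by
    rintro ⟨u, z⟩
    dsimp only
    split_ifs <;> ext <;> dsimp only at * <;> omega

theorem two_mul_triangular (x : ℕ) : 2 * (x * (x + 1) / 2) = x * (x + 1) :=
  Nat.mul_div_cancel' (Nat.even_mul_succ_self x).two_dvd

theorem triangularPairEquiv_spec (p : ℕ × ℕ) :
    (triangularPairEquiv p).1.natAbs ^ 2 +
      2 * ((triangularPairEquiv p).2 * ((triangularPairEquiv p).2 + 1) / 2) =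
    p.1 * (p.1 + 1) / 2 + p.2 * (p.2 + 1) / 2 := by
  obtain ⟨q, rfl⟩ := triangularPairEquiv.symm.surjective p
  obtain ⟨u, z⟩ := q
  rw [Equiv.apply_symm_apply]
  have key : ∀ x y : ℕ, (x : ℤ) * (x + 1) + y * (y + 1) = 2 * (u ^ 2 + z * (z + 1)) →
      u.natAbs ^ 2 + 2 * (z * (z + 1) / 2) = x * (x + 1) / 2 + y * (y + 1) / 2 := by
    intro x y hxy
    have hx := two_mul_triangular x
    have hy := two_mul_triangular y
    rw [two_mul_triangular z]
    zify at hx hy ⊢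
    rw [sq_abs]
    linarith
  apply key
  simp only [triangularPairEquiv, Equiv.coe_fn_symm_mk]
  split_ifs with h₁ h₂
  · rw [Int.toNat_of_nonneg (by omega), Int.toNat_of_nonneg (by omega)]
    ring
  · rw [Int.toNat_of_nonneg (by omega), Int.toNat_of_nonneg (by omega)]
    ring
  · rw [Int.toNat_of_nonneg (by omega), Int.toNat_of_nonneg (by omega)]
    ring

theorem finite_setOf_eq_sum {α : Type*} {k : ℕ} {c : Fin k → ℕ} (hc : ∀ i, 0 < c i)
    {f : α → ℕ} (hf : ∀ m, {a | f a ≤ m}.Finite) (n : ℕ) :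
    {x : Fin k → α | n = ∑ i, c i * f (x i)}.Finite := by
  refine (Set.Finite.pi' fun _ : Fin k => hf n).subset fun x hx i => ?_
  have hx : n = ∑ i, c i * f (x i) := hx
  calc f (x i) ≤ c i * f (x i) := Nat.le_mul_of_pos_left _ (hc i)
    _ ≤ ∑ i, c i * f (x i) :=
      Finset.single_le_sum (f := fun i => c i * f (x i)) (fun _ _ => Nat.zero_le _)
        (Finset.mem_univ i)
    _ = n := hx.symm

theorem finite_setOf_triangular_le (m : ℕ) : {x : ℕ | x * (x + 1) / 2 ≤ m}.Finite := by
  refine (Set.finite_Iic (2 * m)).subset fun x hx => ?_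
  have hx : x * (x + 1) / 2 ≤ m := hx
  have := two_mul_triangular x
  simp only [Set.mem_Iic]
  nlinarith

theorem finite_setOf_natAbs_sq_le (m : ℕ) : {u : ℤ | u.natAbs ^ 2 ≤ m}.Finite := by
  refine (Set.finite_Icc (-(m : ℤ)) m).subset fun u hu => ?_
  have hu : u.natAbs ^ 2 ≤ m := hu
  have := Nat.le_self_pow two_ne_zero u.natAbs
  simp only [Set.mem_Icc]
  omega

theorem rRep_eq_ncard_natAbs (k : ℕ) (c : Fin k → ℕ) (n : ℕ) :
    rRep k c n = Set.ncard {y : Fin k → ℤ | n = ∑ i, c i * (y i).natAbs ^ 2} := by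
  unfold rRep
  congr 1
  ext y
  simp only [Set.mem_ofPred_eq]
  zify
  simp only [sq_abs]

theorem qRep_eq_deltaRep (k : ℕ) (c : Fin k → ℕ) (n : ℕ) :
    qRep k c (8 * n + ∑ i, c i) = deltaRep k c n := by
  have hsum (x : Fin k → ℕ) : ∑ i, c i * (2 * x i + 1) ^ 2 =
      8 * ∑ i, c i * (x i * (x i + 1) / 2) + ∑ i, c i := by
    rw [Finset.mul_sum, ← Finset.sum_add_distrib]
    refine Finset.sum_congr rfl fun i _ => ?_
    have := two_mul_triangular (x i)
    linear_combination 4 * c i * (- this)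
  unfold qRep deltaRep
  symm
  refine Set.ncard_congr (fun x _ i => 2 * x i + 1) (fun x hx => ?_) (fun x y _ _ hxy => ?_)
    (fun y hy => ?_)
  · refine ⟨fun i => ⟨Nat.succ_pos _, x i, rfl⟩, ?_⟩
    rw [hsum, ← show n = _ from hx]
  · funext i
    have : 2 * x i + 1 = 2 * y i + 1 := congrFun hxy i
    omega
  · obtain ⟨hodd, hy⟩ := hy
    choose x hx using fun i => (hodd i).2
    obtain rfl : y = fun i => 2 * x i + 1 := funext hx
    refine ⟨x, ?_, rfl⟩
    rw [hsum] at hy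
    simp only [Set.mem_ofPred_eq]
    omega

/-- `Fin (2 * k)` as `k` consecutive blocks of length two. -/
def finBlockEquiv (k : ℕ) : Fin k × Fin 2 ≃ Fin (2 * k) :=
  finProdFinEquiv.trans (finCongr (Nat.mul_comm k 2))

theorem sum_finBlockEquiv (k : ℕ) (f : Fin (2 * k) → ℕ) :
    ∑ j, f j = ∑ i, (f (finBlockEquiv k (i, 0)) + f (finBlockEquiv k (i, 1))) := by
  rw [← (finBlockEquiv k).sum_comp, Fintype.sum_prod_type]
  simp only [Fin.sum_univ_two]

theorem finBlockEquiv_div_two (k : ℕ) (i : Fin k) (e : Fin 2) :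
    (finBlockEquiv k (i, e) : ℕ) / 2 = i := by
  simp only [finBlockEquiv, Equiv.trans_apply, finCongr_apply, Fin.val_cast,
    finProdFinEquiv_apply_val]
  omega

/-- Tuples of length `2 * k` of natural numbers correspond to a `k`-tuple of integers together
with a `k`-tuple of natural numbers, applying `triangularPairEquiv` blockwise. -/
def doubledTupleEquiv (k : ℕ) : (Fin (2 * k) → ℕ) ≃ (Fin k → ℤ) × (Fin k → ℕ) :=
  ((finBlockEquiv k).symm.arrowCongr (Equiv.refl ℕ)).trans <|
    (Equiv.curry (Fin k) (Fin 2) ℕ).trans <|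
      ((Equiv.refl (Fin k)).arrowCongr
        ((finTwoArrowEquiv ℕ).trans triangularPairEquiv)).trans
          (Equiv.arrowProdEquivProdArrow (Fin k) (fun _ => ℤ) (fun _ => ℕ))

theorem deltaRep_doubled (k : ℕ) (c : Fin k → ℕ) (c2 : Fin (2 * k) → ℕ)
    (h2 : ∀ i e, c2 (finBlockEquiv k (i, e)) = c i) (n : ℕ) :
    deltaRep (2 * k) c2 n = Set.ncard {p : (Fin k → ℤ) × (Fin k → ℕ) |
      n = ∑ i, c i * (p.1 i).natAbs ^ 2 + 2 * ∑ i, c i * (p.2 i * (p.2 i + 1) / 2)} := by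
  have hsum (x : Fin (2 * k) → ℕ) : ∑ j, c2 j * (x j * (x j + 1) / 2) =
      ∑ i, c i * ((doubledTupleEquiv k x).1 i).natAbs ^ 2 +
        2 * ∑ i, c i * ((doubledTupleEquiv k x).2 i * ((doubledTupleEquiv k x).2 i + 1) / 2) := by
    rw [sum_finBlockEquiv, Finset.mul_sum, ← Finset.sum_add_distrib]
    refine Finset.sum_congr rfl fun i _ => ?_
    have := triangularPairEquiv_spec (x (finBlockEquiv k (i, 0)), x (finBlockEquiv k (i, 1)))
    rw [h2, h2, ← mul_add, ← this, mul_add, mul_left_comm 2]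
    rfl
  unfold deltaRep
  simp only [hsum]
  exact Nat.card_congr ((doubledTupleEquiv k).subtypeEquiv fun _ => Iff.rfl)

theorem ncard_eq_sum_convPairs (k : ℕ) (c : Fin k → ℕ) (hc : ∀ i, 0 < c i) (n : ℕ) :
    Set.ncard {p : (Fin k → ℤ) × (Fin k → ℕ) |
      n = ∑ i, c i * (p.1 i).natAbs ^ 2 + 2 * ∑ i, c i * (p.2 i * (p.2 i + 1) / 2)} =
    ∑ p ∈ convPairs n, rRep k c p.1 * deltaRep k c p.2 := by
  simp only [rRep_eq_ncard_natAbs, deltaRep]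
  have hunion : {p : (Fin k → ℤ) × (Fin k → ℕ) |
      n = ∑ i, c i * (p.1 i).natAbs ^ 2 + 2 * ∑ i, c i * (p.2 i * (p.2 i + 1) / 2)} =
      ⋃ p ∈ (convPairs n : Set (ℕ × ℕ)), {y : Fin k → ℤ | p.1 = ∑ i, c i * (y i).natAbs ^ 2} ×ˢ
        {x : Fin k → ℕ | p.2 = ∑ i, c i * (x i * (x i + 1) / 2)} := by
    ext ⟨y, x⟩
    simp only [Set.mem_ofPred_eq, Set.mem_iUnion, Set.mem_prod, exists_prop, Prod.exists,
      convPairs, Finset.mem_coe, Finset.mem_filter, Finset.mem_product, Finset.mem_range]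
    constructor
    · intro h
      exact ⟨_, _, ⟨⟨by omega, by omega⟩, h.symm⟩, rfl, rfl⟩
    · rintro ⟨a, b, ⟨-, h⟩, rfl, rfl⟩
      exact h.symm
  rw [hunion, (convPairs n).finite_toSet.ncard_biUnion, finsum_mem_coe_finset]
  · simp only [Set.ncard_prod]
  · exact fun p _ => (finite_setOf_eq_sum hc finite_setOf_natAbs_sq_le p.1).prod
      (finite_setOf_eq_sum hc finite_setOf_triangular_le p.2)
  · refine fun p _ q _ hpq => Set.disjoint_left.2 ?_
    rintro ⟨y, x⟩ ⟨h₁, h₂⟩ ⟨h₃, h₄⟩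
    exact hpq (Prod.ext (Eq.trans h₁ (Eq.symm h₃)) (Eq.trans h₂ (Eq.symm h₄)))

theorem delta_two_k_relations_coeff (k : ℕ) (c : Fin k → ℕ) (hc : ∀ i, 0 < c i)
    (h : ℕ) (hh : h = ∑ i, c i)
    (c2 : Fin (2 * k) → ℕ)
    (hc2 : c2 = fun i : Fin (2 * k) => c ⟨(i : ℕ) / 2, by have := i.isLt; omega⟩)
    (n : ℕ) :
    qRep (2 * k) c2 (8 * n + 2 * h) = deltaRep (2 * k) c2 n ∧
    deltaRep (2 * k) c2 n =
      ∑ p ∈ convPairs n, rRep k c p.1 * deltaRep k c p.2 ∧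
    (∑ p ∈ convPairs n, rRep k c p.1 * deltaRep k c p.2) =
      ∑ p ∈ convPairs n, rRep k c p.1 * qRep k c (8 * p.2 + h) := by
  have h2 (i : Fin k) (e : Fin 2) : c2 (finBlockEquiv k (i, e)) = c i := by
    rw [hc2]
    exact congrArg c (Fin.ext (finBlockEquiv_div_two k i e))
  have hsum : ∑ j, c2 j = 2 * h := by
    rw [sum_finBlockEquiv, hh, Finset.mul_sum]
    exact Finset.sum_congr rfl fun i _ => by rw [h2, h2, two_mul]
  refine ⟨?_, ?_, ?_⟩
  · rw [← hsum, qRep_eq_deltaRep]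
  · rw [deltaRep_doubled k c c2 h2, ncard_eq_sum_convPairs k c hc]
  · simp only [hh, qRep_eq_deltaRep]
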